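/- Let n, N ≥ 1 and J : ℝⁿ → ℝ^{(6N)×n}. The following are equivalent: (i) the Jacobian J is normal, i.e., there exists γ > 0 such that J(q)ᵀJ(q) − γ·I_n is positive semidefinite for all q ∈ ℝⁿ; (ii) for every constant Θ = (Φ₁,…,Φ_N) ∈ ℝ^{10N} such that f(Φ_l) is positive definite for every l ∈ {1,…,N}, there exists α > 0 such that M(q,Θ) − α·I_n is positive semidefinite for all q ∈ ℝⁿ. -/

import Mathlib

noncomputable section

open Matrix

/-- The skew-symmetric cross-product matrix `𝒮(x)` with `𝒮(x) y = x × y`. -/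
def crossMat (x : Fin 3 → ℝ) : Matrix (Fin 3) (Fin 3) ℝ :=
  !![0, -x 2, x 1; x 2, 0, -x 0; -x 1, x 0, 0]

/-- The first moment of mass `h = (h₁,h₂,h₃)` from `Φ`. -/
def hVec (Φ : Fin 10 → ℝ) : Fin 3 → ℝ := ![Φ 1, Φ 2, Φ 3]

/-- The inertia matrix `I` from `Φ = (m,h₁,h₂,h₃,I₁₁,I₂₂,I₃₃,I₁₂,I₂₃,I₁₃)`. -/
def Imat (Φ : Fin 10 → ℝ) : Matrix (Fin 3) (Fin 3) ℝ :=
  !![Φ 4, Φ 7, Φ 9; Φ 7, Φ 5, Φ 8; Φ 9, Φ 8, Φ 6]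

/-- `Σ = (1/2)·tr(I)·I₃ − I`. -/
def SigmaMat (Φ : Fin 10 → ℝ) : Matrix (Fin 3) (Fin 3) ℝ :=
  ((1 / 2 : ℝ) * (Imat Φ).trace) • (1 : Matrix (Fin 3) (Fin 3) ℝ) - Imat Φ

/-- The 4×4 matrix `f(Φ) = [[Σ, h],[hᵀ, m]]`. -/
def fMat (Φ : Fin 10 → ℝ) : Matrix (Fin 3 ⊕ Fin 1) (Fin 3 ⊕ Fin 1) ℝ :=
  Matrix.fromBlocks (SigmaMat Φ) (Matrix.of fun i _ => hVec Φ i)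
    (Matrix.of fun _ j => hVec Φ j) (Matrix.of fun _ _ => Φ 0)

/-- The 6×6 matrix `Z(Φ) = [[m·I₃, −𝒮(h)],[−𝒮(h)ᵀ, I]]`. -/
def ZMat (Φ : Fin 10 → ℝ) : Matrix (Fin 3 ⊕ Fin 3) (Fin 3 ⊕ Fin 3) ℝ :=
  Matrix.fromBlocks (Φ 0 • (1 : Matrix (Fin 3) (Fin 3) ℝ)) (-(crossMat (hVec Φ)))
    (-(crossMat (hVec Φ))ᵀ) (Imat Φ)

/-- `𝒵(Θ) = blockdiag(Z(Φ₁),…,Z(Φ_N))`. -/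
def calZ {N : ℕ} (Θ : Fin N → Fin 10 → ℝ) :
    Matrix ((Fin 3 ⊕ Fin 3) × Fin N) ((Fin 3 ⊕ Fin 3) × Fin N) ℝ :=
  Matrix.blockDiagonal fun l => ZMat (Θ l)

/-- The mass matrix `M(q,Θ) = J(q)ᵀ 𝒵(Θ) J(q)`. -/
def massMatrix {n N : ℕ}
    (J : (Fin n → ℝ) → Matrix ((Fin 3 ⊕ Fin 3) × Fin N) (Fin n) ℝ)
    (Θ : Fin N → Fin 10 → ℝ) (q : Fin n → ℝ) : Matrix (Fin n) (Fin n) ℝ :=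
  (J q)ᵀ * calZ Θ * J q

open scoped MatrixOrder in
/-- A positive definite real matrix dominates a positive multiple of the identity. -/
theorem Matrix.PosDef.exists_pos_sub_smul_one_posSemidef {ι : Type*} [Fintype ι] [DecidableEq ι]
    {A : Matrix ι ι ℝ} (hA : A.PosDef) :
    ∃ c : ℝ, 0 < c ∧ (A - c • (1 : Matrix ι ι ℝ)).PosSemidef := by
  rcases isEmpty_or_nonempty ι with h | h
  · exact ⟨1, one_pos, Subsingleton.elim 0 (A - _) ▸ .zero⟩
  obtain ⟨c, hc, hle⟩ := (CFC.exists_pos_algebraMap_le_iff (a := A) hA.isHermitian).2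
    fun x hx => hA.isStrictlyPositive.spectrum_pos hx
  exact ⟨c, hc, by simpa [Matrix.le_iff, Algebra.algebraMap_eq_smul_one] using hle⟩

/-- A block diagonal matrix with positive definite blocks is positive definite. -/
theorem Matrix.PosDef.blockDiagonal {ι κ : Type*} [Fintype ι] [Fintype κ] [DecidableEq κ]
    {A : κ → Matrix ι ι ℝ} (hA : ∀ k, (A k).PosDef) : (Matrix.blockDiagonal A).PosDef := by
  refine .of_dotProduct_mulVec_pos ?_ fun x hx => ?_
  · rw [Matrix.IsHermitian, Matrix.blockDiagonal_conjTranspose]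
    exact congrArg _ (funext fun k => (hA k).isHermitian)
  have hsum : star x ⬝ᵥ (Matrix.blockDiagonal A *ᵥ x) =
      ∑ k, star (fun i => x (i, k)) ⬝ᵥ (A k *ᵥ fun i => x (i, k)) := by
    simp only [dotProduct, mulVec, Fintype.sum_prod_type, blockDiagonal_apply]
    rw [Finset.sum_comm]
    simp
  rw [hsum]
  obtain ⟨⟨i, k⟩, hik⟩ := Function.ne_iff.1 hx
  refine Finset.sum_pos' (fun l _ => (hA l).posSemidef.dotProduct_mulVec_nonneg _)
    ⟨k, Finset.mem_univ k, (hA k).dotProduct_mulVec_pos ?_⟩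
  exact Function.ne_iff.2 ⟨i, hik⟩

/-- For the twist `x = (v, ω)`, the vector `u` such that the `k`-th component of the velocity
`v + ω × r` is the pairing of `u` with `(r, 1)`. -/
def velocityCoeff (x : Fin 3 ⊕ Fin 3 → ℝ) (k : Fin 3) : Fin 3 ⊕ Fin 1 → ℝ :=
  Sum.elim (crossMat (fun i => x (.inr i)) k) fun _ => x (.inl k)

theorem ZMat_quadForm (Φ : Fin 10 → ℝ) (x : Fin 3 ⊕ Fin 3 → ℝ) :
    star x ⬝ᵥ (ZMat Φ *ᵥ x) =
      ∑ k, star (velocityCoeff x k) ⬝ᵥ (fMat Φ *ᵥ velocityCoeff x k) := by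
  simp [dotProduct, mulVec, Fin.sum_univ_three, ZMat, fMat, velocityCoeff, SigmaMat, Imat, hVec,
    crossMat, Matrix.trace, Matrix.one_apply]
  ring

theorem ZMat_isHermitian (Φ : Fin 10 → ℝ) : (ZMat Φ).IsHermitian := by
  rw [ZMat, Matrix.isHermitian_fromBlocks_iff]
  refine ⟨?_, ?_, ?_, ?_⟩
  · simp [Matrix.IsHermitian]
  · simp
  · simp
  · ext i j
    fin_cases i <;> fin_cases j <;> simp [Imat]

/-- If the pseudo-inertia matrix `f(Φ)` is positive definite, so is the spatial inertia `Z(Φ)`. -/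
theorem ZMat_posDef {Φ : Fin 10 → ℝ} (hΦ : (fMat Φ).PosDef) : (ZMat Φ).PosDef := by
  refine .of_dotProduct_mulVec_pos (ZMat_isHermitian Φ) fun x hx => ?_
  rw [ZMat_quadForm]
  have hex : ∃ k, velocityCoeff x k ≠ 0 := by
    by_contra! h
    refine hx (funext ?_)
    have hω (k i : Fin 3) : crossMat (fun i => x (.inr i)) k i = 0 := congrFun (h k) (.inl i)
    rintro (k | k)
    · exact congrFun (h k) (.inr 0)
    · fin_cases k
      · simpa [crossMat] using hω 2 1
      · simpa [crossMat] using hω 0 2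
      · simpa [crossMat] using hω 1 0
  obtain ⟨k, hk⟩ := hex
  exact Finset.sum_pos' (fun _ _ => hΦ.posSemidef.dotProduct_mulVec_nonneg _)
    ⟨k, Finset.mem_univ k, hΦ.dotProduct_mulVec_pos hk⟩

/-- The inertial parameters of a body with unit mass, centred at the origin, and unit inertia. -/
def unitParams : Fin 10 → ℝ := ![1, 0, 0, 0, 1, 1, 1, 0, 0, 0]

theorem hVec_unitParams : hVec unitParams = 0 := by
  simp [hVec, unitParams]

theorem Imat_unitParams : Imat unitParams = 1 := by
  simp [Imat, unitParams, Matrix.one_fin_three]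

theorem ZMat_unitParams : ZMat unitParams = 1 := by
  have hcross : crossMat 0 = 0 := by
    ext i j
    fin_cases i <;> fin_cases j <;> simp [crossMat]
  have hmass : unitParams 0 = 1 := rfl
  simp [ZMat, hVec_unitParams, Imat_unitParams, hcross, hmass]

theorem fMat_unitParams_posDef : (fMat unitParams).PosDef := by
  have hSigma : SigmaMat unitParams = Matrix.diagonal fun _ => 1 / 2 := by
    ext i j
    by_cases hij : i = j <;> norm_num [SigmaMat, Imat_unitParams, Matrix.one_apply, hij]
  have h : fMat unitParams = Matrix.diagonal (Sum.elim (fun _ => 1 / 2) fun _ => 1) := by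
    rw [← Matrix.fromBlocks_diagonal, fMat, hSigma, hVec_unitParams]
    congr 1
    ext i j
    simp [unitParams, Subsingleton.elim i j]
  rw [h, Matrix.posDef_diagonal_iff]
  rintro (i | i) <;> norm_num

/-- The Jacobian is normal iff for every constant physically consistent set of inertial
parameters the mass matrix has a positive lower uniform bound. -/
theorem jacobian_normal_iff_massMatrix_lower_bound {n N : ℕ} (hn : 1 ≤ n) (hN : 1 ≤ N)
    (J : (Fin n → ℝ) → Matrix ((Fin 3 ⊕ Fin 3) × Fin N) (Fin n) ℝ) :
    (∃ γ : ℝ, 0 < γ ∧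
        ∀ q, ((J q)ᵀ * J q - γ • (1 : Matrix (Fin n) (Fin n) ℝ)).PosSemidef) ↔
      ∀ Θ : Fin N → Fin 10 → ℝ, (∀ l, (fMat (Θ l)).PosDef) →
        ∃ α : ℝ, 0 < α ∧
          ∀ q, (massMatrix J Θ q - α • (1 : Matrix (Fin n) (Fin n) ℝ)).PosSemidef := by
  constructor
  · rintro ⟨γ, hγ, hJ⟩ Θ hΘ
    have hZ : (calZ Θ).PosDef := .blockDiagonal fun l => ZMat_posDef (hΘ l)
    obtain ⟨c, hc, hcZ⟩ := hZ.exists_pos_sub_smul_one_posSemidef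
    refine ⟨c * γ, mul_pos hc hγ, fun q => ?_⟩
    have hsplit : massMatrix J Θ q - (c * γ) • (1 : Matrix (Fin n) (Fin n) ℝ) =
        (J q)ᴴ * (calZ Θ - c • 1) * J q + c • ((J q)ᵀ * J q - γ • 1) := by
      simp [massMatrix, conjTranspose_eq_transpose_of_trivial, Matrix.mul_sub, Matrix.sub_mul,
        smul_sub, smul_smul]
    rw [hsplit]
    exact (hcZ.conjTranspose_mul_mul_same _).add ((hJ q).smul hc.le)
  · intro h
    simpa [massMatrix, calZ, ZMat_unitParams, ← Pi.one_def] using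
      h (fun _ => unitParams) fun _ => fMat_unitParams_posDef

end
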